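/- For any x ∈ ℝ³ with x ≠ 0, and any closed ball B centered at x not containing 0, one has θ(‖x‖) ≤ (1/|B|) ∫_B θ(‖y‖) dy, where θ is the radial function defined by θ(r) = (360/121)(11/5)^{1/6} r^{-1} - 25/11 for 0 < r ≤ (11/5)^{1/6} and θ(r) = -r^{-12} + 2r^{-6} for r > (11/5)^{1/6}. -/

import Mathlib

open MeasureTheory

open Real

/-- Tangent-line inequality for a differentiable function with monotone derivative. -/
theorem add_deriv_mul_sub_le {D : Set ℝ} (hD : Convex ℝ D) {f f' : ℝ → ℝ}
    (hf : ∀ s, HasDerivAt f (f' s) s) (hmono : MonotoneOn f' D) {s t : ℝ}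
    (hs : s ∈ D) (ht : t ∈ D) : f s + f' s * (t - s) ≤ f t := by
  have hconv : ConvexOn ℝ D f := by
    refine MonotoneOn.convexOn_of_deriv hD
      (fun x _ => (hf x).continuousAt.continuousWithinAt)
      (fun x _ => (hf x).differentiableAt.differentiableWithinAt) ?_
    rw [funext fun x => (hf x).deriv]
    exact hmono.mono interior_subset
  rcases lt_trichotomy s t with h | rfl | h
  · have := hconv.le_slope_of_hasDerivAt hs ht h (hf s)
    rw [slope_def_field, le_div_iff₀ (by linarith)] at this
    linarith
  · simp
  · have := hconv.slope_le_of_hasDerivAt ht hs h (hf s)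
    rw [slope_def_field, div_le_iff₀ (by linarith)] at this
    linarith

theorem integral_mul_inv_sqrt_sq_add_sq {t h : ℝ} (ht : 0 < t) :
    ∫ r in 0..h, r * (√(t ^ 2 + r ^ 2))⁻¹ = √(t ^ 2 + h ^ 2) - t := by
  have hd : ∀ r : ℝ, HasDerivAt (fun r => √(t ^ 2 + r ^ 2)) (r * (√(t ^ 2 + r ^ 2))⁻¹) r := by
    intro r
    have hpos : t ^ 2 + r ^ 2 ≠ 0 := by positivity
    convert ((hasDerivAt_pow 2 r).const_add (t ^ 2)).sqrt hpos using 1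
    norm_num
    field_simp
  rw [intervalIntegral.integral_eq_sub_of_hasDerivAt (fun r _ => hd r)]
  · simp [Real.sqrt_sq ht.le]
  · refine Continuous.intervalIntegrable ?_ _ _
    have : ∀ r : ℝ, √(t ^ 2 + r ^ 2) ≠ 0 := fun r => by positivity
    fun_prop (disch := exact this _)

/-- The Newtonian potential of a planar disc of radius `h`, at height `t` on its axis. -/
theorem integral_disc_inv_sqrt_sq_add_sq {t h : ℝ} (ht : 0 < t) (hh : 0 ≤ h) :
    ∫ p : EuclideanSpace ℝ (Fin 2), (if ‖p‖ ≤ h then (√(t ^ 2 + ‖p‖ ^ 2))⁻¹ else 0)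
      = 2 * π * (√(t ^ 2 + h ^ 2) - t) := by
  rw [integral_fun_norm_addHaar volume (fun r => if r ≤ h then (√(t ^ 2 + r ^ 2))⁻¹ else 0)]
  have hset : ∫ r in Set.Ioi (0 : ℝ), r ^ (Module.finrank ℝ (EuclideanSpace ℝ (Fin 2)) - 1) •
      (if r ≤ h then (√(t ^ 2 + r ^ 2))⁻¹ else 0) = √(t ^ 2 + h ^ 2) - t := by
    rw [← integral_mul_inv_sqrt_sq_add_sq ht, intervalIntegral.integral_of_le hh,
      ← Set.Ioi_inter_Iic, ← setIntegral_indicator measurableSet_Iic]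
    congr 1
    ext r
    by_cases hr : r ≤ h <;> simp [hr]
  rw [hset, Measure.real, EuclideanSpace.volume_ball_fin_two]
  simp [ENNReal.toReal_ofReal pi_pos.le]
  ring

theorem integral_sqrt_sub_self {d R : ℝ} (hR : 0 < R) (hRd : R < d) :
    ∫ t in (d - R)..(d + R), (√(2 * t * d + R ^ 2 - d ^ 2) - t) = 2 * R ^ 3 / (3 * d) := by
  have hpos : ∀ t ∈ Set.uIcc (d - R) (d + R), 0 < 2 * t * d + R ^ 2 - d ^ 2 := by
    intro t ht
    rw [Set.uIcc_of_le (by linarith)] at ht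
    nlinarith [ht.1, mul_pos (sub_pos.2 hRd) (sub_pos.2 hRd)]
  have hd0 : d ≠ 0 := by linarith
  have hd : ∀ t ∈ Set.uIcc (d - R) (d + R),
      HasDerivAt (fun t => (2 * t * d + R ^ 2 - d ^ 2) * √(2 * t * d + R ^ 2 - d ^ 2) / (3 * d)
        - t ^ 2 / 2) (√(2 * t * d + R ^ 2 - d ^ 2) - t) t := by
    intro t ht
    have h0 := hpos t ht
    have hu : HasDerivAt (fun t => 2 * t * d + R ^ 2 - d ^ 2) (2 * d) t := by
      simpa using ((((hasDerivAt_id t).const_mul 2).mul_const d).add_const (R ^ 2)).sub_const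
        (d ^ 2)
    refine (((hu.mul (hu.sqrt h0.ne')).div_const (3 * d)).sub
      ((hasDerivAt_pow 2 t).div_const 2)).congr_deriv ?_
    have hs := Real.sq_sqrt h0.le
    have hs0 := (Real.sqrt_pos.2 h0).ne'
    generalize √(2 * t * d + R ^ 2 - d ^ 2) = s at *
    rw [← hs]
    field_simp
    norm_num
    ring
  rw [intervalIntegral.integral_eq_sub_of_hasDerivAt hd
    (Continuous.intervalIntegrable (by fun_prop) _ _)]
  have h1 : 2 * (d + R) * d + R ^ 2 - d ^ 2 = (d + R) ^ 2 := by ring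
  have h2 : 2 * (d - R) * d + R ^ 2 - d ^ 2 = (d - R) ^ 2 := by ring
  rw [h1, h2, Real.sqrt_sq (by linarith), Real.sqrt_sq (by linarith)]
  field_simp
  ring

theorem exists_linearIsometryEquiv_apply_eq {E F : Type*} [NormedAddCommGroup E]
    [InnerProductSpace ℝ E] [FiniteDimensional ℝ E] [NormedAddCommGroup F] [InnerProductSpace ℝ F]
    [FiniteDimensional ℝ F] (h : Module.finrank ℝ E = Module.finrank ℝ F) {v : E} {w : F}
    (hvw : ‖v‖ = ‖w‖) : ∃ e : E ≃ₗᵢ[ℝ] F, e v = w := by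
  let e := (stdOrthonormalBasis ℝ E).equiv (stdOrthonormalBasis ℝ F) (finCongr h)
  exact ⟨e.trans (Submodule.reflection (ℝ ∙ (e v - w))ᗮ),
    Submodule.reflection_sub (by simpa using hvw)⟩

theorem norm_pos_of_mem_closedBall {E : Type*} [NormedAddCommGroup E] {x y : E} {R : ℝ}
    (hRx : R < ‖x‖) (hy : y ∈ Metric.closedBall x R) : 0 < ‖y‖ := by
  rw [mem_closedBall_iff_norm'] at hy
  linarith [norm_sub_norm_le x y]

theorem continuousOn_inv_norm_closedBall {E : Type*} [NormedAddCommGroup E] {x : E} {R : ℝ}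
    (hRx : R < ‖x‖) : ContinuousOn (fun y : E => ‖y‖⁻¹) (Metric.closedBall x R) :=
  continuous_norm.continuousOn.inv₀ fun _ hy => (norm_pos_of_mem_closedBall hRx hy).ne'

/-- The mean value property of the Newtonian kernel on a ball that avoids the origin. -/
theorem setIntegral_closedBall_inv_norm {x : EuclideanSpace ℝ (Fin 3)} {R : ℝ} (hR : 0 < R)
    (hRx : R < ‖x‖) :
    ∫ y in Metric.closedBall x R, ‖y‖⁻¹ = 4 * π * R ^ 3 / (3 * ‖x‖) := by
  let P := EuclideanSpace ℝ (Fin 2)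
  set d := ‖x‖ with hd
  have hd0 : 0 < d := hR.trans hRx
  obtain ⟨e, he⟩ := exists_linearIsometryEquiv_apply_eq (E := WithLp 2 (ℝ × P))
    (F := EuclideanSpace ℝ (Fin 3)) (v := WithLp.toLp 2 (d, 0)) (w := x)
    (by rw [(WithLp.linearEquiv 2 ℝ (ℝ × P)).finrank_eq]; simp [P])
    (by simp [hd])
  have hmp : MeasurePreserving (fun p : ℝ × P => e (WithLp.toLp 2 p)) :=
    e.measurePreserving.comp (WithLp.volume_preserving_toLp ℝ P)
  have hemb : MeasurableEmbedding (fun p : ℝ × P => e (WithLp.toLp 2 p)) :=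
    e.toMeasurableEquiv.measurableEmbedding.comp
      (MeasurableEquiv.toLp 2 (ℝ × P)).measurableEmbedding
  set g : EuclideanSpace ℝ (Fin 3) → ℝ :=
    (Metric.closedBall x R).indicator fun y => ‖y‖⁻¹ with hg
  have hgint : Integrable g :=
    (integrable_indicator_iff measurableSet_closedBall).2
      ((continuousOn_inv_norm_closedBall hRx).integrableOn_compact (isCompact_closedBall x R))
  have hgp : ∀ t : ℝ, ∀ p : P, g (e (WithLp.toLp 2 (t, p)))
      = if (t - d) ^ 2 + ‖p‖ ^ 2 ≤ R ^ 2 then (√(t ^ 2 + ‖p‖ ^ 2))⁻¹ else 0 := by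
    intro t p
    have hmem : e (WithLp.toLp 2 (t, p)) ∈ Metric.closedBall x R ↔
        (t - d) ^ 2 + ‖p‖ ^ 2 ≤ R ^ 2 := by
      rw [← he, mem_closedBall_iff_norm, ← map_sub, e.norm_map, ← WithLp.toLp_sub,
        WithLp.prod_norm_eq_of_L2, Real.sqrt_le_left hR.le]
      simp
    by_cases h : (t - d) ^ 2 + ‖p‖ ^ 2 ≤ R ^ 2
    · rw [hg, Set.indicator_of_mem (hmem.2 h), if_pos h, e.norm_map, WithLp.prod_norm_eq_of_L2]
      simp
    · rw [hg, Set.indicator_of_notMem (mt hmem.1 h), if_neg h]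
  have hslice : ∀ t : ℝ, ∫ p : P, g (e (WithLp.toLp 2 (t, p)))
      = (Set.Icc (d - R) (d + R)).indicator
        (fun t => 2 * π * (√(2 * t * d + R ^ 2 - d ^ 2) - t)) t := by
    intro t
    simp only [hgp]
    by_cases ht : t ∈ Set.Icc (d - R) (d + R)
    · rw [Set.indicator_of_mem ht]
      have h0 : 0 ≤ R ^ 2 - (t - d) ^ 2 := by nlinarith [ht.1, ht.2]
      have key := integral_disc_inv_sqrt_sq_add_sq (t := t) (by linarith [ht.1])
        (Real.sqrt_nonneg (R ^ 2 - (t - d) ^ 2))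
      rw [Real.sq_sqrt h0] at key
      simp only [Real.le_sqrt (norm_nonneg _) h0, le_sub_iff_add_le'] at key
      rw [key]
      congr 3
      ring
    · rw [Set.indicator_of_notMem ht]
      have hn : ∀ p : P, ¬ (t - d) ^ 2 + ‖p‖ ^ 2 ≤ R ^ 2 := by
        intro p hp
        have h2 : |t - d| ≤ R := abs_le_of_sq_le_sq (by nlinarith [sq_nonneg ‖p‖]) hR.le
        rw [abs_le] at h2
        exact ht ⟨by linarith, by linarith⟩
      simp [hn]
  rw [← integral_indicator measurableSet_closedBall, ← hg, ← hmp.integral_comp hemb,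
    Measure.volume_eq_prod, integral_prod _ (by
      rw [← Measure.volume_eq_prod]; exact (hmp.integrable_comp_emb hemb).2 hgint)]
  simp only [hslice]
  rw [integral_indicator measurableSet_Icc, integral_Icc_eq_integral_Ioc,
    ← intervalIntegral.integral_of_le (by linarith), intervalIntegral.integral_const_mul,
    integral_sqrt_sub_self hR hRx]
  ring

/-- Jensen's inequality for radial functions that are convex in `r⁻¹`. -/
theorem le_average_closedBall_of_subgradient_inv {f : ℝ → ℝ} (hf : ContinuousOn f (Set.Ioi 0))
    {x : EuclideanSpace ℝ (Fin 3)} {R m : ℝ} (hR : 0 < R) (hRx : R < ‖x‖)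
    (hm : ∀ r : ℝ, 0 < r → f ‖x‖ + m * (r⁻¹ - ‖x‖⁻¹) ≤ f r) :
    f ‖x‖ ≤ (1 / (volume (Metric.closedBall x R)).toReal)
      * ∫ y in Metric.closedBall x R, f ‖y‖ := by
  have hx0 : 0 < ‖x‖ := hR.trans hRx
  have hfi : IntegrableOn (fun y => f ‖y‖) (Metric.closedBall x R) :=
    (hf.comp continuous_norm.continuousOn
      fun _ hy => norm_pos_of_mem_closedBall hRx hy).integrableOn_compact (isCompact_closedBall x R)
  have hinv : IntegrableOn (fun y => ‖y‖⁻¹) (Metric.closedBall x R) :=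
    (continuousOn_inv_norm_closedBall hRx).integrableOn_compact (isCompact_closedBall x R)
  have hconst : ∀ c : ℝ, IntegrableOn (fun _ => c) (Metric.closedBall x R) :=
    fun c => continuousOn_const.integrableOn_compact (isCompact_closedBall x R)
  have hvol : (volume (Metric.closedBall x R)).toReal = 4 * π * R ^ 3 / 3 := by
    rw [EuclideanSpace.volume_closedBall_fin_three, ENNReal.toReal_mul, ENNReal.toReal_pow,
      ENNReal.toReal_ofReal hR.le, ENNReal.toReal_ofReal (by positivity)]
    ring
  have hV : 0 < (volume (Metric.closedBall x R)).toReal := by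
    rw [hvol]
    positivity
  have hlin : IntegrableOn (fun y => m * (‖y‖⁻¹ - ‖x‖⁻¹)) (Metric.closedBall x R) :=
    (hinv.sub (hconst _)).const_mul m
  have hle : ∫ y in Metric.closedBall x R, (f ‖x‖ + m * (‖y‖⁻¹ - ‖x‖⁻¹))
      ≤ ∫ y in Metric.closedBall x R, f ‖y‖ :=
    setIntegral_mono_on ((hconst _).add hlin) hfi
      measurableSet_closedBall fun y hy => hm _ (norm_pos_of_mem_closedBall hRx hy)
  rw [integral_add (hconst _) hlin, integral_const_mul,
    integral_sub hinv (hconst _), setIntegral_closedBall_inv_norm hR hRx, setIntegral_const,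
    setIntegral_const, Measure.real, hvol] at hle
  rw [one_div, inv_mul_eq_div, le_div_iff₀ hV, hvol]
  refine le_trans (le_of_eq ?_) hle
  simp only [smul_eq_mul]
  field_simp
  ring

theorem monotoneOn_deriv_two_mul_pow_six_sub_pow_twelve {b : ℝ} (hb6 : b ^ 6 ≤ 5 / 11) :
    MonotoneOn (fun s : ℝ => 12 * s ^ 5 - 12 * s ^ 11) (Set.Icc 0 b) := by
  have hd : ∀ s : ℝ, HasDerivAt (fun s : ℝ => 12 * s ^ 5 - 12 * s ^ 11)
      (60 * s ^ 4 - 132 * s ^ 10) s := fun s =>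
    (((hasDerivAt_pow 5 s).const_mul 12).sub ((hasDerivAt_pow 11 s).const_mul 12)).congr_deriv
      (by norm_num; ring)
  refine monotoneOn_of_deriv_nonneg (convex_Icc 0 b) (by fun_prop)
    (fun s _ => (hd s).differentiableAt.differentiableWithinAt) fun s hs => ?_
  rw [(hd s).deriv]
  have hs' := interior_subset hs
  have h6 : s ^ 6 ≤ 5 / 11 := (pow_le_pow_left₀ hs'.1 hs'.2 6).trans hb6
  have h4 : 0 ≤ s ^ 4 := by positivity
  nlinarith [mul_nonneg h4 (sub_nonneg.2 h6)]

theorem stmt_11 (θ : ℝ → ℝ)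
    (hθ₁ : ∀ r : ℝ, 0 < r → r ≤ (11/5 : ℝ) ^ ((1:ℝ)/6) →
      θ r = (360/121) * (11/5 : ℝ) ^ ((1:ℝ)/6) * r⁻¹ - 25/11)
    (hθ₂ : ∀ r : ℝ, (11/5 : ℝ) ^ ((1:ℝ)/6) < r → θ r = -r ^ (-12 : ℤ) + 2 * r ^ (-6 : ℤ))
    (x : EuclideanSpace ℝ (Fin 3)) (hx : x ≠ 0) (R : ℝ) (hR : 0 < R)
    (hB : (0 : EuclideanSpace ℝ (Fin 3)) ∉ Metric.closedBall x R) :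
    θ ‖x‖ ≤ (1 / (volume (Metric.closedBall x R)).toReal)
      * ∫ y in Metric.closedBall x R, θ ‖y‖ := by
  have hRx : R < ‖x‖ := by simpa using hB
  have hx0 : 0 < ‖x‖ := norm_pos_iff.2 hx
  have ha0 : 0 < (11/5 : ℝ) ^ ((1:ℝ)/6) := by positivity
  have ha6 : ((11/5 : ℝ) ^ ((1:ℝ)/6)) ^ 6 = 11 / 5 := by
    rw [← Real.rpow_natCast, ← Real.rpow_mul (by norm_num)]
    norm_num
  generalize (11/5 : ℝ) ^ ((1:ℝ)/6) = a at *
  obtain ⟨b, hb⟩ : ∃ b, b = a⁻¹ := ⟨_, rfl⟩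
  have hb0 : 0 < b := hb ▸ inv_pos.2 ha0
  have hab : a * b = 1 := hb ▸ mul_inv_cancel₀ ha0.ne'
  have hb6 : b ^ 6 = 5 / 11 := by
    rw [hb, inv_pow, ha6]
    norm_num
  set P : ℝ → ℝ := fun s => 2 * s ^ 6 - s ^ 12 with hP
  set P' : ℝ → ℝ := fun s => 12 * s ^ 5 - 12 * s ^ 11 with hP'
  have hmono : MonotoneOn P' (Set.Icc 0 b) :=
    monotoneOn_deriv_two_mul_pow_six_sub_pow_twelve hb6.le
  have hd : ∀ s, HasDerivAt P (P' s) s := fun s =>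
    (((hasDerivAt_pow 6 s).const_mul 2).sub (hasDerivAt_pow 12 s)).congr_deriv
      (by simp only [hP']; norm_num; ring)
  have htan : ∀ s ∈ Set.Icc 0 b, ∀ t ∈ Set.Icc 0 b, P s + P' s * (t - s) ≤ P t :=
    fun s hs t ht => add_deriv_mul_sub_le (convex_Icc 0 b) hd hmono hs ht
  have hbmem : b ∈ Set.Icc 0 b := ⟨hb0.le, le_rfl⟩
  have hPb : P b = 85 / 121 := by
    simp only [hP, show b ^ 12 = (b ^ 6) ^ 2 by ring, hb6]
    norm_num
  have hP'b : P' b = 360 / 121 * a := by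
    have h5 : b ^ 5 = a * b ^ 6 := by linear_combination (-b ^ 5) * hab
    have h11 : b ^ 11 = a * (b ^ 6) ^ 2 := by linear_combination (-b ^ 11) * hab
    simp only [hP', h5, h11, hb6]
    ring
  have hnear : ∀ r, 0 < r → r ≤ a → b ≤ r⁻¹ ∧ θ r = P b + P' b * (r⁻¹ - b) := by
    intro r hr hra
    refine ⟨hb ▸ inv_anti₀ hr hra, ?_⟩
    rw [hθ₁ r hr hra, hPb, hP'b]
    linear_combination (360 / 121) * hab
  have hfar : ∀ r, a < r → r⁻¹ ∈ Set.Icc 0 b ∧ θ r = P r⁻¹ := by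
    intro r hr
    refine ⟨⟨(inv_pos.2 (ha0.trans hr)).le, hb ▸ inv_anti₀ ha0 hr.le⟩, ?_⟩
    rw [hθ₂ r hr]
    simp only [hP, zpow_neg, inv_pow]
    norm_cast
    ring
  have hcont : ContinuousOn θ (Set.Ioi 0) := by
    have hform : Set.EqOn θ (fun r => P' b * (max r⁻¹ b - b) + P (min r⁻¹ b)) (Set.Ioi 0) := by
      intro r hr
      rcases le_or_gt r a with h | h
      · obtain ⟨h1, h2⟩ := hnear r hr h
        simp only [max_eq_left h1, min_eq_right h1, h2]
        ring
      · obtain ⟨h1, h2⟩ := hfar r h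
        simp only [max_eq_right h1.2, min_eq_left h1.2, h2]
        ring
    refine ContinuousOn.congr ?_ hform
    have hi : ContinuousOn (fun r : ℝ => r⁻¹) (Set.Ioi 0) :=
      continuousOn_inv₀.mono fun r hr => ne_of_gt hr
    simp only [hP]
    fun_prop
  rcases le_or_gt ‖x‖ a with h | h
  · obtain ⟨-, hx2⟩ := hnear _ hx0 h
    refine le_average_closedBall_of_subgradient_inv hcont (m := P' b) hR hRx fun r hr => ?_
    rcases le_or_gt r a with h' | h'
    · rw [hx2, (hnear r hr h').2]
      exact le_of_eq (by ring)
    · obtain ⟨hr1, hr2⟩ := hfar r h'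
      rw [hx2, hr2]
      linarith [htan b hbmem _ hr1]
  · obtain ⟨hx1, hx2⟩ := hfar _ h
    refine le_average_closedBall_of_subgradient_inv hcont (m := P' ‖x‖⁻¹) hR hRx fun r hr => ?_
    rcases le_or_gt r a with h' | h'
    · obtain ⟨hr1, hr2⟩ := hnear r hr h'
      rw [hx2, hr2]
      nlinarith [htan _ hx1 b hbmem,
        mul_nonneg (sub_nonneg.2 (hmono hx1 hbmem hx1.2)) (sub_nonneg.2 hr1)]
    · obtain ⟨hr1, hr2⟩ := hfar r h'
      rw [hx2, hr2]
      exact htan _ hx1 _ hr1
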